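/- Let (g, Φ = (D, θ), ⟨·,·⟩) be an extrinsic symmetric triple with n = dim g₋⁻ ≥ 1. Suppose that D = ad ξ for some ξ ∈ g with θ(ξ) = −ξ, and that ⟨x,y⟩ = μ·B_g(x,y) for all x,y ∈ g, where B_g(x,y) = tr(ad x ∘ ad y) is the Killing form of g and μ ≠ 0 is a real number. Then the mean curvature vector satisfies h = (1/(2nμ))·ξ, and consequently A_h(u) = −(1/(2nμ))·u for all u ∈ g₋⁻. -/

import Mathlib

/-- The span of all brackets `⁅u, v⁆` with `u ∈ U`, `v ∈ V`. -/
def bracketSpan {L : Type} [LieRing L] [LieAlgebra ℝ L]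
    (U V : Submodule ℝ L) : Submodule ℝ L :=
  Submodule.span ℝ {z | ∃ u ∈ U, ∃ v ∈ V, z = ⁅u, v⁆}

/-- An extrinsic symmetric triple `(g, (D, θ), ⟨·,·⟩)`: a metric Lie algebra with an
invariant nondegenerate symmetric bilinear form, an isometric involutive automorphism `θ`,
and an antisymmetric derivation `D` with `D³ = -D`, `Dθ = -θD` and `g₊⁺ = [g₊⁻, g₊⁻]`. -/
structure ExtSymTriple (L : Type) [LieRing L] [LieAlgebra ℝ L] [Module.Finite ℝ L] where
  B : LinearMap.BilinForm ℝ L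
  Bsymm : ∀ x y, B x y = B y x
  Binv : ∀ x y z, B ⁅x, y⁆ z = B x ⁅y, z⁆
  Bnondeg : B.Nondegenerate
  theta : L →ₗ[ℝ] L
  thetaLie : ∀ x y, theta ⁅x, y⁆ = ⁅theta x, theta y⁆
  thetaInvol : ∀ x, theta (theta x) = x
  thetaIso : ∀ x y, B (theta x) (theta y) = B x y
  D : L →ₗ[ℝ] L
  Dder : ∀ x y, D ⁅x, y⁆ = ⁅D x, y⁆ + ⁅x, D y⁆
  Danti : ∀ x y, B (D x) y = - B x (D y)
  D3 : ∀ x, D (D (D x)) = - D x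
  Dtheta : ∀ x, D (theta x) = - theta (D x)
  cartan : (LinearMap.ker (theta - LinearMap.id) ⊓ LinearMap.ker D) =
    bracketSpan
      (LinearMap.ker (theta - LinearMap.id) ⊓ LinearMap.ker (D ∘ₗ D + LinearMap.id))
      (LinearMap.ker (theta - LinearMap.id) ⊓ LinearMap.ker (D ∘ₗ D + LinearMap.id))

namespace ExtSymTriple

variable {L : Type} [LieRing L] [LieAlgebra ℝ L] [Module.Finite ℝ L] (T : ExtSymTriple L)

/-- `g₊⁺ = g₊ ∩ g⁺`. -/
def gPlusUp : Submodule ℝ L :=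
  LinearMap.ker (T.theta - LinearMap.id) ⊓ LinearMap.ker T.D

/-- `g₊⁻ = g₊ ∩ g⁻`. -/
def gPlusDown : Submodule ℝ L :=
  LinearMap.ker (T.theta - LinearMap.id) ⊓ LinearMap.ker (T.D ∘ₗ T.D + LinearMap.id)

/-- `g₋⁺ = g₋ ∩ g⁺`. -/
def gMinusUp : Submodule ℝ L :=
  LinearMap.ker (T.theta + LinearMap.id) ⊓ LinearMap.ker T.D

/-- `g₋⁻ = g₋ ∩ g⁻`. -/
def gMinusDown : Submodule ℝ L :=
  LinearMap.ker (T.theta + LinearMap.id) ⊓ LinearMap.ker (T.D ∘ₗ T.D + LinearMap.id)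

/-- Indecomposability: `g` is not the direct sum of two nonzero ideals that are orthogonal
to each other and invariant under `θ` and `D`. -/
def Indecomposable : Prop :=
  ¬ ∃ I J : LieIdeal ℝ L, I ≠ ⊥ ∧ J ≠ ⊥ ∧
    (I : Submodule ℝ L) ⊓ (J : Submodule ℝ L) = ⊥ ∧
    (I : Submodule ℝ L) ⊔ (J : Submodule ℝ L) = ⊤ ∧
    (∀ x ∈ I, ∀ y ∈ J, T.B x y = 0) ∧
    (∀ x ∈ I, T.theta x ∈ I) ∧ (∀ x ∈ I, T.D x ∈ I) ∧
    (∀ x ∈ J, T.theta x ∈ J) ∧ (∀ x ∈ J, T.D x ∈ J)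

end ExtSymTriple

/-- The operator `x ↦ ∑ⱼ κⱼ ⟨eⱼ, x⟩ eⱼ`: the orthogonal projection onto the span of `e` when `e`
is orthonormal with signs `κ`. -/
def signedProjection {L ι : Type*} [AddCommGroup L] [Module ℝ L] [Fintype ι]
    (B : LinearMap.BilinForm ℝ L) (e : ι → L) (κ : ι → ℝ) : L →ₗ[ℝ] L :=
  ∑ j, (κ j • B (e j)).smulRight (e j)

section signedProjection

variable {L ι : Type*} [AddCommGroup L] [Module ℝ L] [Fintype ι]
  (B : LinearMap.BilinForm ℝ L) (e : ι → L) (κ : ι → ℝ)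

theorem signedProjection_apply (x : L) :
    signedProjection B e κ x = ∑ j, (κ j * B (e j) x) • e j := by
  simp [signedProjection]

theorem trace_comp_signedProjection [Module.Finite ℝ L] (A : L →ₗ[ℝ] L) :
    LinearMap.trace ℝ L (A ∘ₗ signedProjection B e κ) = ∑ j, κ j * B (e j) (A (e j)) := by
  have hA : A ∘ₗ signedProjection B e κ = ∑ j, (κ j • B (e j)).smulRight (A (e j)) := by
    ext x
    simp [signedProjection_apply]
  rw [hA, map_sum]
  refine Finset.sum_congr rfl fun j _ => ?_
  rw [LinearMap.trace_smulRight]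
  simp

theorem signedProjection_eq_self (horth : ∀ i j, i ≠ j → B (e i) (e j) = 0)
    (hκ : ∀ j, B (e j) (e j) = κ j) (hκ1 : ∀ j, κ j = 1 ∨ κ j = -1)
    {x : L} (hx : x ∈ Submodule.span ℝ (Set.range e)) : signedProjection B e κ x = x := by
  have heq : Set.EqOn (signedProjection B e κ) (LinearMap.id : L →ₗ[ℝ] L) (Set.range e) := by
    rintro _ ⟨i, rfl⟩
    rw [signedProjection_apply, Finset.sum_eq_single i]
    · rw [hκ]
      rcases hκ1 i with h | h <;> simp [h]
    · intro j _ hji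
      simp [horth j i hji]
    · simp
  exact LinearMap.eqOn_span heq hx

end signedProjection

namespace ExtSymTriple

variable {L : Type} [LieRing L] [LieAlgebra ℝ L] [Module.Finite ℝ L] (T : ExtSymTriple L)

theorem mem_gMinusDown {x : L} : x ∈ T.gMinusDown ↔ T.theta x = -x ∧ T.D (T.D x) = -x := by
  simp [gMinusDown, add_eq_zero_iff_eq_neg]

theorem projection_mem_gMinusDown (x : L) :
    (-(1 / 2 : ℝ)) • T.D (T.D (x - T.theta x)) ∈ T.gMinusDown := by
  have hcomm (y : L) : T.theta (T.D (T.D y)) = T.D (T.D (T.theta y)) := by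
    simp [T.Dtheta]
  rw [mem_gMinusDown]
  constructor
  · rw [map_smul, hcomm, map_sub, T.thetaInvol, ← neg_sub x, map_neg, map_neg, smul_neg]
  · rw [map_smul, map_smul, T.D3, smul_neg]

theorem form_projection {e : L} (he : e ∈ T.gMinusDown) (x : L) :
    T.B e ((-(1 / 2 : ℝ)) • T.D (T.D (x - T.theta x))) = T.B e x := by
  obtain ⟨hθ, hD⟩ := T.mem_gMinusDown.1 he
  have h1 (y : L) : T.B e (T.D (T.D y)) = -T.B e y := by
    rw [← neg_eq_iff_eq_neg, ← T.Danti, ← neg_eq_iff_eq_neg.2 (T.Danti _ _), hD]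
    simp
  have h2 : T.B e (T.theta x) = -T.B e x := by
    rw [← T.thetaIso e x, hθ]
    simp
  rw [map_smul, h1, map_sub, h2, smul_eq_mul]
  ring

variable {ι : Type*} [Fintype ι] {e : ι → L} {κ : ι → ℝ}

theorem signedProjection_eq (hmem : ∀ j, e j ∈ T.gMinusDown)
    (hspan : ∀ x ∈ T.gMinusDown, x ∈ Submodule.span ℝ (Set.range e))
    (horth : ∀ i j, i ≠ j → T.B (e i) (e j) = 0)
    (hκ : ∀ j, T.B (e j) (e j) = κ j) (hκ1 : ∀ j, κ j = 1 ∨ κ j = -1) (x : L) :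
    signedProjection T.B e κ x = (-(1 / 2 : ℝ)) • T.D (T.D (x - T.theta x)) := by
  rw [← signedProjection_eq_self T.B e κ horth hκ hκ1
    (hspan _ (T.projection_mem_gMinusDown x)), signedProjection_apply, signedProjection_apply]
  exact Finset.sum_congr rfl fun j _ => by rw [T.form_projection (hmem j)]

/-- `D` exchanges `g₊⁻` and `g₋⁻` and vanishes on `g⁺`, so `D = P D + D P` for the projection `P`
onto `g₋⁻`. -/
theorem D_eq_signedProjection (hmem : ∀ j, e j ∈ T.gMinusDown)
    (hspan : ∀ x ∈ T.gMinusDown, x ∈ Submodule.span ℝ (Set.range e))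
    (horth : ∀ i j, i ≠ j → T.B (e i) (e j) = 0)
    (hκ : ∀ j, T.B (e j) (e j) = κ j) (hκ1 : ∀ j, κ j = 1 ∨ κ j = -1) :
    T.D = signedProjection T.B e κ ∘ₗ T.D + T.D ∘ₗ signedProjection T.B e κ := by
  ext x
  have hθ : T.theta (T.D x) = -T.D (T.theta x) := by rw [T.Dtheta, neg_neg]
  simp only [LinearMap.add_apply, LinearMap.comp_apply,
    T.signedProjection_eq hmem hspan horth hκ hκ1, hθ, map_smul, map_sub, map_neg, T.D3]
  module

theorem trace_D_comp_ad (hmem : ∀ j, e j ∈ T.gMinusDown)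
    (hspan : ∀ x ∈ T.gMinusDown, x ∈ Submodule.span ℝ (Set.range e))
    (horth : ∀ i j, i ≠ j → T.B (e i) (e j) = 0)
    (hκ : ∀ j, T.B (e j) (e j) = κ j) (hκ1 : ∀ j, κ j = 1 ∨ κ j = -1) (x : L) :
    LinearMap.trace ℝ L (T.D ∘ₗ LieAlgebra.ad ℝ L x) =
      2 * T.B (∑ j, κ j • ⁅T.D (e j), e j⁆) x := by
  set P := signedProjection T.B e κ with hP
  set A : L →ₗ[ℝ] L := LieAlgebra.ad ℝ L x with hA
  have hsplit : T.D ∘ₗ A = P ∘ₗ (T.D ∘ₗ A) + T.D ∘ₗ (P ∘ₗ A) := by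
    conv_lhs => rw [T.D_eq_signedProjection hmem hspan horth hκ hκ1]
    rfl
  have hbr (j : ι) : T.B ⁅T.D (e j), e j⁆ x = -T.B (T.D (e j)) ⁅x, e j⁆ := by
    rw [T.Binv, ← lie_skew, map_neg]
  have h1 (j : ι) : T.B (e j) (T.D (A (e j))) = T.B ⁅T.D (e j), e j⁆ x := by
    rw [hbr, T.Danti, neg_neg]
    rfl
  have h2 (j : ι) : T.B (e j) (A (T.D (e j))) = T.B ⁅T.D (e j), e j⁆ x := by
    change T.B (e j) ⁅x, T.D (e j)⁆ = _
    rw [hbr, ← T.Binv, ← lie_skew, map_neg, LinearMap.neg_apply, T.Bsymm]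
  have hcycle : LinearMap.trace ℝ L (T.D ∘ₗ (P ∘ₗ A)) =
      LinearMap.trace ℝ L ((A ∘ₗ T.D) ∘ₗ P) := by
    rw [← LinearMap.comp_assoc, LinearMap.trace_comp_comm', LinearMap.comp_assoc]
  rw [hsplit, map_add, LinearMap.trace_comp_comm', hcycle, hP, trace_comp_signedProjection,
    trace_comp_signedProjection]
  simp only [LinearMap.comp_apply, h1, h2, map_sum, map_smul, LinearMap.sum_apply,
    LinearMap.smul_apply, smul_eq_mul]
  ring

end ExtSymTriple

/-- **Proposition 1.** If `D = ad ξ` with `θ ξ = -ξ` and `⟨·,·⟩ = μ · B_g` with `μ ≠ 0`,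
then the mean curvature vector is `h = (1/(2nμ)) ξ`, and consequently the shape operator
satisfies `A_h u = -⁅Du, h⁆ = -(1/(2nμ)) u` for all `u ∈ g₋⁻`. -/
theorem meanCurvature_of_semisimple
    {L : Type} [LieRing L] [LieAlgebra ℝ L] [Module.Finite ℝ L]
    (T : ExtSymTriple L)
    (n : ℕ) (hn : 1 ≤ n) (hdim : n = Module.finrank ℝ T.gMinusDown)
    (e : Fin n → L) (hmem : ∀ j, e j ∈ T.gMinusDown)
    (hspan : ∀ x ∈ T.gMinusDown, x ∈ Submodule.span ℝ (Set.range e))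
    (horth : ∀ i j, i ≠ j → T.B (e i) (e j) = 0)
    (κ : Fin n → ℝ) (hκ : ∀ j, T.B (e j) (e j) = κ j) (hκ1 : ∀ j, κ j = 1 ∨ κ j = -1)
    (h : L) (hh : h = (n : ℝ)⁻¹ • ∑ j, κ j • ⁅T.D (e j), e j⁆)
    (ξ : L) (hξ : ∀ x, T.D x = ⁅ξ, x⁆) (hθξ : T.theta ξ = -ξ)
    (μ : ℝ) (hμ : μ ≠ 0)
    (hB : ∀ x y, T.B x y = μ * killingForm ℝ L x y) :
    h = (2 * (n : ℝ) * μ)⁻¹ • ξ ∧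
      ∀ u ∈ T.gMinusDown, -⁅T.D u, h⁆ = -((2 * (n : ℝ) * μ)⁻¹ • u) := by
  have hn0 : (n : ℝ) ≠ 0 := by
    have : 0 < n := hn
    positivity
  have hD : T.D = LieAlgebra.ad ℝ L ξ := LinearMap.ext hξ
  have hform (x : L) : T.B ξ x = (2 * n * μ) * T.B h x := by
    have htr := T.trace_D_comp_ad hmem hspan horth hκ hκ1 x
    rw [hB ξ x, killingForm_apply_apply, ← hD, htr, hh]
    simp only [map_smul, LinearMap.smul_apply, smul_eq_mul]
    field_simp
  have hmean : h = (2 * (n : ℝ) * μ)⁻¹ • ξ := by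
    rw [← sub_eq_zero]
    refine T.Bnondeg.1 _ fun x => ?_
    simp only [map_sub, map_smul, LinearMap.sub_apply, LinearMap.smul_apply, smul_eq_mul, hform]
    field_simp
    ring
  refine ⟨hmean, fun u hu => ?_⟩
  rw [hmean, lie_smul, ← smul_neg, lie_skew, ← hξ, (T.mem_gMinusDown.1 hu).2, smul_neg]
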